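/- Fix an integer n ≥ 3. There exist constants c, C > 0 depending only on n such that for all 0 < a < b with a/b ∈ (0, 1/2], every principal Dirichlet eigenfunction φ of the annulus A_{a,b} ⊆ ℝⁿ satisfies, for every x ∈ A_{a,b}: c·Ψ(x) ≤ φ(x) ≤ C·Ψ(x), where Ψ(x) := b^{−n/2} · ( 1 − (a/|x|)^{n−2} ) · ( 1 − |x|/b ). -/

import Mathlib

open Real MeasureTheory

noncomputable def dirichletEigenvalue (n : ℕ) (U : Set (EuclideanSpace ℝ (Fin n))) : ℝ :=
  sInf {R : ℝ | ∃ f : EuclideanSpace ℝ (Fin n) → ℝ,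
    ContDiff ℝ (⊤ : ℕ∞) f ∧ HasCompactSupport f ∧ tsupport f ⊆ U ∧ f ≠ 0 ∧
    R = (∫ x, ‖fderiv ℝ f x‖ ^ 2) / (∫ x, (f x) ^ 2)}

def annulus (n : ℕ) (a b : ℝ) : Set (EuclideanSpace ℝ (Fin n)) :=
  {x | a < ‖x‖ ∧ ‖x‖ < b}

/-- The Laplacian as the sum of the unmixed second partial derivatives. -/
noncomputable def laplacian {n : ℕ} (φ : EuclideanSpace ℝ (Fin n) → ℝ)
    (x : EuclideanSpace ℝ (Fin n)) : ℝ :=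
  ∑ i : Fin n, fderiv ℝ (fun y => fderiv ℝ φ y (EuclideanSpace.single i 1)) x
    (EuclideanSpace.single i 1)

/-- `φ` is a principal Dirichlet eigenfunction of the nonempty bounded open set `U`. -/
structure IsPrincipalDirichletEigenfunction {n : ℕ} (U : Set (EuclideanSpace ℝ (Fin n)))
    (φ : EuclideanSpace ℝ (Fin n) → ℝ) : Prop where
  continuousOn : ContinuousOn φ (closure U)
  smooth : ContDiffOn ℝ (⊤ : ℕ∞) φ U
  pos : ∀ x ∈ U, 0 < φ x
  vanishes : ∀ x ∈ frontier U, φ x = 0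
  eigenEq : ∀ x ∈ U, laplacian φ x = -(dirichletEigenvalue n U) * φ x
  normalized : (∫ x in U, (φ x) ^ 2) = 1

open Set Filter Topology

section LaplacianCalculus

variable {n : ℕ} {f g : EuclideanSpace ℝ (Fin n) → ℝ} {x : EuclideanSpace ℝ (Fin n)}

theorem fderiv_fderiv_eq_iteratedFDeriv (hf : ContDiffAt ℝ 2 f x)
    (v w : EuclideanSpace ℝ (Fin n)) :
    fderiv ℝ (fun y => fderiv ℝ f y v) x w = iteratedFDeriv ℝ 2 f x ![w, v] := by
  have hd : DifferentiableAt ℝ (fderiv ℝ f) x :=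
    (hf.fderiv_right (m := 1) (by norm_num)).differentiableAt (by norm_num)
  rw [iteratedFDeriv_two_apply, fderiv_clm_apply hd (by fun_prop)]
  simp

theorem laplacian_eq_mathlib (hf : ContDiffAt ℝ 2 f x) :
    laplacian f x = Laplacian.laplacian f x := by
  rw [InnerProductSpace.laplacian_eq_iteratedFDeriv_orthonormalBasis f
    (EuclideanSpace.basisFun (Fin n) ℝ), laplacian]
  exact Finset.sum_congr rfl fun i _ => by
    rw [fderiv_fderiv_eq_iteratedFDeriv hf, EuclideanSpace.basisFun_apply]

theorem laplacian_sub (hf : ContDiffAt ℝ 2 f x) (hg : ContDiffAt ℝ 2 g x) :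
    laplacian (fun y => f y - g y) x = laplacian f x - laplacian g x := by
  rw [laplacian_eq_mathlib hf, laplacian_eq_mathlib hg, laplacian_eq_mathlib (hf.sub hg)]
  exact hf.laplacian_sub hg

theorem laplacian_const_mul (c : ℝ) (hf : ContDiffAt ℝ 2 f x) :
    laplacian (fun y => c * f y) x = c * laplacian f x := by
  rw [laplacian_eq_mathlib hf, laplacian_eq_mathlib (contDiffAt_const.mul hf)]
  exact InnerProductSpace.laplacian_smul c hf

theorem laplacian_const (c : ℝ) :
    laplacian (fun _ : EuclideanSpace ℝ (Fin n) => c) x = 0 := by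
  simp [laplacian]

theorem laplacian_comp_linearIsometryEquiv
    (L : EuclideanSpace ℝ (Fin n) ≃ₗᵢ[ℝ] EuclideanSpace ℝ (Fin n))
    (hf : ContDiffAt ℝ 2 f (L x)) :
    laplacian (fun y => f (L y)) x = laplacian f (L x) := by
  have hderiv : ∀ (h : EuclideanSpace ℝ (Fin n) → ℝ) (y v : EuclideanSpace ℝ (Fin n)),
      fderiv ℝ (fun z => h (L z)) y v = fderiv ℝ h (L y) (L v) := fun h y v => by
    have := L.toContinuousLinearEquiv.comp_right_fderiv (f := h) (x := y)
    exact congrArg (fun T => T v) this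
  rw [laplacian_eq_mathlib hf, InnerProductSpace.laplacian_eq_iteratedFDeriv_orthonormalBasis f
    ((EuclideanSpace.basisFun (Fin n) ℝ).map L), laplacian]
  refine Finset.sum_congr rfl fun i _ => ?_
  simp_rw [hderiv f]
  rw [hderiv (fun z => fderiv ℝ f z (L (EuclideanSpace.single i 1))),
    fderiv_fderiv_eq_iteratedFDeriv hf]
  simp

theorem laplacian_comp_smul (b : ℝ) :
    laplacian (fun y => f (b • y)) x = b ^ 2 * laplacian f (b • x) := by
  have hderiv : ∀ (h : EuclideanSpace ℝ (Fin n) → ℝ) (y v : EuclideanSpace ℝ (Fin n)),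
      fderiv ℝ (fun z => h (b • z)) y v = b * fderiv ℝ h (b • y) v := fun h y v => by
    rw [fderiv_comp_smul]
    simp
  simp only [laplacian, hderiv f, Finset.mul_sum]
  refine Finset.sum_congr rfl fun i _ => ?_
  have h := congrFun (fderiv_const_smul_field (𝕜 := ℝ) b
    (f := fun y => fderiv ℝ f (b • y) (EuclideanSpace.single i 1))) x
  refine (congrArg (fun T => T (EuclideanSpace.single i 1)) h).trans ?_
  simp only [Pi.smul_apply, _root_.smul_apply, smul_eq_mul,
    hderiv (fun z => fderiv ℝ f z (EuclideanSpace.single i 1))]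
  ring

theorem laplacian_nonneg_of_isLocalMin (hf : ContDiffAt ℝ 2 f x) (hmin : IsLocalMin f x) :
    0 ≤ laplacian f x := by
  refine Finset.sum_nonneg fun i _ => ?_
  set v := EuclideanSpace.single i (1 : ℝ) with hv
  by_contra! hneg
  set c : ℝ → EuclideanSpace ℝ (Fin n) := fun t => x + t • v with hc
  have hc0 : c 0 = x := by simp [hc]
  have hcd : ∀ t, HasDerivAt c v t := fun t => by
    have := ((hasDerivAt_id t).smul_const v).const_add x
    rwa [one_smul] at this
  have hcc : ContinuousAt c 0 := (hcd 0).continuousAt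
  have hct : Tendsto c (𝓝 0) (𝓝 x) := by simpa [ContinuousAt, hc0] using hcc
  have hdiff : ∀ᶠ y in 𝓝 x, DifferentiableAt ℝ f y :=
    (hf.eventually (by simp)).mono fun y hy => hy.differentiableAt (by norm_num)
  have hd1 : deriv (fun t => f (c t)) =ᶠ[𝓝 0] fun t => fderiv ℝ f (c t) v :=
    (hct.eventually hdiff).mono fun t ht =>
      (ht.hasFDerivAt.comp_hasDerivAt t (hcd t)).deriv
  have hdd : DifferentiableAt ℝ (fun y => fderiv ℝ f y v) x :=
    ((hf.fderiv_right (m := 1) (by norm_num)).differentiableAt (by norm_num)).clm_apply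
      (by fun_prop)
  have hd2 : deriv (deriv fun t => f (c t)) 0 = fderiv ℝ (fun y => fderiv ℝ f y v) x v := by
    rw [hd1.deriv_eq]
    have h := hdd.hasFDerivAt
    rw [← hc0] at h
    have h' := (h.comp_hasDerivAt 0 (hcd 0)).deriv
    rw [hc0] at h'
    exact h'
  have hmin' : IsLocalMin (fun t => f (c t)) 0 := by
    have := hct.eventually hmin
    simpa [IsLocalMin, IsMinFilter, hc0] using this
  have hcont : ContinuousAt (fun t => f (c t)) 0 := by
    refine ContinuousAt.comp ?_ hcc
    rw [hc0]; exact hf.continuousAt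
  have hmax := isLocalMax_of_deriv_deriv_neg (hd2 ▸ hneg) hmin'.deriv_eq_zero hcont
  have hconst : (fun t => f (c t)) =ᶠ[𝓝 0] fun _ => f (c 0) := by
    filter_upwards [hmax, hmin'] with t h1 h2 using le_antisymm h1 h2
  have hz : deriv (deriv fun t => f (c t)) 0 = 0 := by
    rw [hconst.deriv.deriv_eq]; simp
  linarith [hd2 ▸ hz]

theorem laplacian_radial {G G' : ℝ → ℝ} {G'' : ℝ} (p : EuclideanSpace ℝ (Fin n))
    (hG : ∀ᶠ s in 𝓝 (‖x - p‖ ^ 2), HasDerivAt G (G' s) s)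
    (hG' : HasDerivAt G' G'' (‖x - p‖ ^ 2)) :
    laplacian (fun y => G (‖y - p‖ ^ 2)) x =
      2 * n * G' (‖x - p‖ ^ 2) + 4 * ‖x - p‖ ^ 2 * G'' := by
  have hq : ∀ y : EuclideanSpace ℝ (Fin n),
      HasFDerivAt (fun y => ‖y - p‖ ^ 2) (2 • innerSL ℝ (y - p)) y := fun y => by
    simpa using ((hasFDerivAt_id y).sub_const p).norm_sq
  have hqt : Tendsto (fun y : EuclideanSpace ℝ (Fin n) => ‖y - p‖ ^ 2) (𝓝 x)
      (𝓝 (‖x - p‖ ^ 2)) := (hq x).continuousAt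
  have hinner : ∀ (i : Fin n) (y : EuclideanSpace ℝ (Fin n)),
      (innerSL ℝ (y - p)) (EuclideanSpace.single i (1 : ℝ)) = y i - p i := fun i y => by
    simp [EuclideanSpace.inner_single_right]
  have hterm : ∀ i : Fin n,
      fderiv ℝ (fun y => fderiv ℝ (fun y => G (‖y - p‖ ^ 2)) y (EuclideanSpace.single i 1)) x
        (EuclideanSpace.single i 1) = 2 * G' (‖x - p‖ ^ 2) + 4 * G'' * (x i - p i) ^ 2 := by
    intro i
    have h1 : (fun y => fderiv ℝ (fun y => G (‖y - p‖ ^ 2)) y (EuclideanSpace.single i 1))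
        =ᶠ[𝓝 x] fun y => G' (‖y - p‖ ^ 2) * (2 * (y i - p i)) := by
      filter_upwards [hqt.eventually hG] with y hy
      have h : HasFDerivAt (fun y => G (‖y - p‖ ^ 2)) (G' (‖y - p‖ ^ 2) • 2 • innerSL ℝ (y - p)) y :=
        hy.comp_hasFDerivAt y (hq y)
      rw [h.fderiv, ← hinner]
      simp
    have hcoord : HasFDerivAt (fun y : EuclideanSpace ℝ (Fin n) => 2 * (y i - p i))
        ((2 : ℝ) • (EuclideanSpace.proj i : EuclideanSpace ℝ (Fin n) →L[ℝ] ℝ)) x :=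
      (((EuclideanSpace.proj i : EuclideanSpace ℝ (Fin n) →L[ℝ] ℝ).hasFDerivAt).sub_const
        (p i)).const_mul 2
    have h2 : HasFDerivAt (fun y => G' (‖y - p‖ ^ 2)) (G'' • 2 • innerSL ℝ (x - p)) x :=
      hG'.comp_hasFDerivAt x (hq x)
    rw [h1.fderiv_eq]
    refine (congrArg (fun T => T (EuclideanSpace.single i 1)) (h2.mul hcoord).fderiv).trans ?_
    have := hinner i x
    simp only [_root_.add_apply, _root_.smul_apply, this, smul_eq_mul,
      nsmul_eq_mul]
    simp
    ring
  have hnorm : ‖x - p‖ ^ 2 = ∑ i, (x i - p i) ^ 2 := by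
    simp [EuclideanSpace.norm_sq_eq]
  rw [laplacian, Finset.sum_congr rfl fun i _ => hterm i, Finset.sum_add_distrib,
    ← Finset.mul_sum, ← Finset.mul_sum, ← hnorm]
  simp
  ring

theorem laplacian_norm_sub_sq (p : EuclideanSpace ℝ (Fin n)) :
    laplacian (fun y => ‖y - p‖ ^ 2) x = 2 * n := by
  have := laplacian_radial (x := x) (G := fun s => s) (G' := fun _ => 1) (G'' := 0) p
    (Eventually.of_forall fun s => hasDerivAt_id s) (hasDerivAt_const _ _)
  simpa using this

theorem laplacian_norm_sq : laplacian (fun y : EuclideanSpace ℝ (Fin n) => ‖y‖ ^ 2) x = 2 * n := by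
  simpa using laplacian_norm_sub_sq (x := x) 0

theorem contDiffAt_inv_norm_sub_pow (m : ℕ) {p : EuclideanSpace ℝ (Fin n)} (hx : x ≠ p) :
    ContDiffAt ℝ 2 (fun y => (‖y - p‖ ^ m)⁻¹) x := by
  have h : x - p ≠ 0 := sub_ne_zero.2 hx
  exact (((contDiffAt_norm ℝ h).comp x (contDiffAt_id.sub contDiffAt_const)).pow m).inv
    (pow_ne_zero _ (norm_ne_zero_iff.2 h))

/-- The fundamental solution is harmonic away from its pole. -/
theorem laplacian_inv_norm_sub_pow (hn : 2 ≤ n) {p : EuclideanSpace ℝ (Fin n)} (hx : x ≠ p) :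
    laplacian (fun y => (‖y - p‖ ^ (n - 2))⁻¹) x = 0 := by
  have hpos : 0 < ‖x - p‖ ^ 2 := by
    have := norm_pos_iff.2 (sub_ne_zero.2 hx)
    positivity
  set α : ℝ := 1 - n / 2 with hα
  have hrw : (fun y : EuclideanSpace ℝ (Fin n) => (‖y - p‖ ^ (n - 2))⁻¹) =
      fun y => (fun s : ℝ => s ^ α) (‖y - p‖ ^ 2) := by
    ext y
    have : ((n - 2 : ℕ) : ℝ) = n - 2 := by push_cast [Nat.cast_sub hn]; ring
    simp only
    rw [← Real.rpow_natCast, ← Real.rpow_natCast, ← Real.rpow_mul (norm_nonneg _),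
      ← Real.rpow_neg (norm_nonneg _), this, hα]
    congr 1
    push_cast; ring
  rw [hrw, laplacian_radial (G := fun s => s ^ α) (G' := fun s => α * s ^ (α - 1))
    (G'' := α * ((α - 1) * (‖x - p‖ ^ 2) ^ (α - 1 - 1))) p]
  · rw [Real.rpow_sub_one hpos.ne' (α - 1)]
    generalize ‖x - p‖ ^ 2 = s at hpos
    have hn' : (n : ℝ) = 2 * (1 - α) := by rw [hα]; ring
    rw [hn']
    field_simp
    ring
  · filter_upwards [lt_mem_nhds hpos] with s hs
    exact Real.hasDerivAt_rpow_const (Or.inl hs.ne')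
  · exact (Real.hasDerivAt_rpow_const (Or.inl hpos.ne')).const_mul α

end LaplacianCalculus

section MaximumPrinciple

variable {n : ℕ}

theorem nonneg_of_superharmonic (hn : 0 < n) {K U : Set (EuclideanSpace ℝ (Fin n))}
    {u : EuclideanSpace ℝ (Fin n) → ℝ} (hK : IsCompact K) (hU : IsOpen U) (hUK : U ⊆ K)
    (hc : ContinuousOn u K) (hs : ∀ x ∈ U, ContDiffAt ℝ 2 u x)
    (hΔ : ∀ x ∈ U, laplacian u x ≤ 0) (hb : ∀ x ∈ K, x ∉ U → 0 ≤ u x) :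
    ∀ x ∈ K, 0 ≤ u x := by
  intro x₀ hx₀
  by_contra! hneg
  obtain ⟨R, hR⟩ := hK.isBounded.exists_norm_le
  set ε : ℝ := -u x₀ / (2 * (R ^ 2 + 1)) with hε
  have hεpos : 0 < ε := by
    have : 0 < -u x₀ := by linarith
    positivity
  have hεR : ε * R ^ 2 < -u x₀ := by
    have : ε * (2 * (R ^ 2 + 1)) = -u x₀ := by rw [hε]; field_simp
    nlinarith [sq_nonneg R]
  have hqc : ContinuousOn (fun x : EuclideanSpace ℝ (Fin n) => ε * ‖x‖ ^ 2) K := by fun_prop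
  obtain ⟨y, hyK, hy⟩ := hK.exists_isMinOn ⟨x₀, hx₀⟩ (hc.sub hqc)
  have hyx : u y - ε * ‖y‖ ^ 2 ≤ u x₀ - ε * ‖x₀‖ ^ 2 := hy hx₀
  by_cases hyU : y ∈ U
  · have hq : ContDiffAt ℝ 2 (fun x : EuclideanSpace ℝ (Fin n) => ‖x‖ ^ 2) y :=
      (contDiff_norm_sq ℝ).contDiffAt
    have hmin : IsLocalMin (fun x => u x - ε * ‖x‖ ^ 2) y :=
      hy.isLocalMin (Filter.mem_of_superset (hU.mem_nhds hyU) hUK)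
    have h := laplacian_nonneg_of_isLocalMin ((hs y hyU).sub (contDiffAt_const.mul hq)) hmin
    rw [laplacian_sub (hs y hyU) (contDiffAt_const.mul hq), laplacian_const_mul ε hq,
      laplacian_norm_sq] at h
    have hn' : (0 : ℝ) < n := by exact_mod_cast hn
    have : 0 < ε * (2 * n) := by positivity
    linarith [hΔ y hyU]
  · have h1 := hb y hyK hyU
    have h2 : ‖y‖ ^ 2 ≤ R ^ 2 := pow_le_pow_left₀ (norm_nonneg _) (hR y hyK) 2
    have h3 : ε * ‖y‖ ^ 2 ≤ ε * R ^ 2 := by gcongr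
    have h4 : 0 ≤ ε * ‖x₀‖ ^ 2 := by positivity
    linarith

theorem le_of_laplacian_le_on_shell (hn : 0 < n) {u v : EuclideanSpace ℝ (Fin n) → ℝ}
    {p : EuclideanSpace ℝ (Fin n)} {r R : ℝ}
    (hu : ContinuousOn u {x | r ≤ ‖x - p‖ ∧ ‖x - p‖ ≤ R})
    (hv : ContinuousOn v {x | r ≤ ‖x - p‖ ∧ ‖x - p‖ ≤ R})
    (hus : ∀ x, r < ‖x - p‖ → ‖x - p‖ < R → ContDiffAt ℝ 2 u x)
    (hvs : ∀ x, r < ‖x - p‖ → ‖x - p‖ < R → ContDiffAt ℝ 2 v x)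
    (hΔ : ∀ x, r < ‖x - p‖ → ‖x - p‖ < R → laplacian u x ≤ laplacian v x)
    (hinner : ∀ x, ‖x - p‖ = r → v x ≤ u x) (houter : ∀ x, ‖x - p‖ = R → v x ≤ u x) :
    ∀ x, r ≤ ‖x - p‖ → ‖x - p‖ ≤ R → v x ≤ u x := by
  have hd : Continuous fun x : EuclideanSpace ℝ (Fin n) => ‖x - p‖ := by fun_prop
  have hclosed : IsClosed {x : EuclideanSpace ℝ (Fin n) | r ≤ ‖x - p‖ ∧ ‖x - p‖ ≤ R} :=
    (isClosed_le continuous_const hd).inter (isClosed_le hd continuous_const)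
  have hopen : IsOpen {x : EuclideanSpace ℝ (Fin n) | r < ‖x - p‖ ∧ ‖x - p‖ < R} :=
    (isOpen_lt continuous_const hd).inter (isOpen_lt hd continuous_const)
  have hcompact : IsCompact {x : EuclideanSpace ℝ (Fin n) | r ≤ ‖x - p‖ ∧ ‖x - p‖ ≤ R} :=
    (isCompact_closedBall p R).of_isClosed_subset hclosed fun x hx => by
      simpa [dist_eq_norm] using hx.2
  intro x hr hR
  refine sub_nonneg.1 (nonneg_of_superharmonic hn hcompact hopen
    (fun x hx => ⟨hx.1.le, hx.2.le⟩) (hu.sub hv)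
    (fun x hx => (hus x hx.1 hx.2).sub (hvs x hx.1 hx.2)) (fun x hx => ?_)
    (fun x hx hx' => ?_) x ⟨hr, hR⟩)
  · have := laplacian_sub (hus x hx.1 hx.2) (hvs x hx.1 hx.2)
    have h := hΔ x hx.1 hx.2
    exact (this.le).trans (by linarith)
  · rcases hx.1.eq_or_lt with h | h
    · exact sub_nonneg.2 (hinner x h.symm)
    · exact sub_nonneg.2 (houter x (le_antisymm hx.2 (not_lt.1 fun h' => hx' ⟨h, h'⟩)))

theorem le_of_laplacian_le_on_annulus (hn : 0 < n) {u v : EuclideanSpace ℝ (Fin n) → ℝ} {r R : ℝ}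
    (hu : ContinuousOn u {x | r ≤ ‖x‖ ∧ ‖x‖ ≤ R})
    (hv : ContinuousOn v {x | r ≤ ‖x‖ ∧ ‖x‖ ≤ R})
    (hus : ∀ x, r < ‖x‖ → ‖x‖ < R → ContDiffAt ℝ 2 u x)
    (hvs : ∀ x, r < ‖x‖ → ‖x‖ < R → ContDiffAt ℝ 2 v x)
    (hΔ : ∀ x, r < ‖x‖ → ‖x‖ < R → laplacian u x ≤ laplacian v x)
    (hinner : ∀ x, ‖x‖ = r → v x ≤ u x) (houter : ∀ x, ‖x‖ = R → v x ≤ u x) :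
    ∀ x, r ≤ ‖x‖ → ‖x‖ ≤ R → v x ≤ u x := by
  have h := le_of_laplacian_le_on_shell (u := u) (v := v) (p := 0) (r := r) (R := R) hn
  simp only [sub_zero] at h
  exact h hu hv hus hvs hΔ hinner houter

theorem pos_on_ball_of_superharmonic (hn : 3 ≤ n) {w : EuclideanSpace ℝ (Fin n) → ℝ}
    {p : EuclideanSpace ℝ (Fin n)} {R : ℝ} (hs : ∀ x ∈ Metric.closedBall p R, ContDiffAt ℝ 2 w x)
    (hΔ : ∀ x ∈ Metric.closedBall p R, laplacian w x ≤ 0)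
    (hw : ∀ x ∈ Metric.closedBall p R, 0 ≤ w x) (hp : 0 < w p) :
    ∀ x ∈ Metric.ball p R, 0 < w x := by
  intro x hx
  have hR : 0 < R := dist_nonneg.trans_lt hx
  have hcont := (hs p (Metric.mem_closedBall_self hR.le)).continuousAt
  obtain ⟨δ, hδ, hball⟩ := Metric.eventually_nhds_iff.1
    (hcont.eventually (lt_mem_nhds (half_lt_self hp)))
  set ρ := min (δ / 2) (R / 2) with hρ
  have hρ0 : 0 < ρ := by positivity
  have hρδ : ρ < δ := (min_le_left _ _).trans_lt (half_lt_self hδ)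
  have hm : ∀ y, ‖y - p‖ ≤ ρ → w p / 2 < w y := fun y hy =>
    hball (by rw [dist_eq_norm]; exact hy.trans_lt hρδ)
  rw [Metric.mem_ball, dist_eq_norm] at hx
  rcases le_total ‖x - p‖ ρ with h | h
  · exact (half_pos hp).trans (hm x h)
  have hne : ∀ y, ρ ≤ ‖y - p‖ → y ≠ p := fun y hy hyp => by
    simp [hyp] at hy; linarith
  have hmem : ∀ y, ‖y - p‖ ≤ R → y ∈ Metric.closedBall p R := fun y hy => by
    rwa [Metric.mem_closedBall, dist_eq_norm]
  set k := w p / 2 * ρ ^ (n - 2) with hk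
  have hk0 : 0 < k := by positivity
  have hbs : ∀ y, ρ ≤ ‖y - p‖ →
      ContDiffAt ℝ 2 (fun y => k * (‖y - p‖ ^ (n - 2))⁻¹) y := fun y hy =>
    contDiffAt_const.mul (contDiffAt_inv_norm_sub_pow _ (hne y hy))
  have hcomp := le_of_laplacian_le_on_shell (n := n) (by lia) (u := w) (p := p) (r := ρ) (R := R)
    (v := fun y => k * (‖y - p‖ ^ (n - 2))⁻¹ - k * (R ^ (n - 2))⁻¹)
    (fun y hy => (hs y (hmem y hy.2)).continuousAt.continuousWithinAt)
    (fun y hy => ((hbs y hy.1).sub contDiffAt_const).continuousAt.continuousWithinAt)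
    (fun y _ hy => hs y (hmem y hy.le)) (fun y hy _ => (hbs y hy.le).sub contDiffAt_const)
    (fun y hy hy' => by
      rw [laplacian_sub (hbs y hy.le) contDiffAt_const, laplacian_const,
        laplacian_const_mul k (contDiffAt_inv_norm_sub_pow _ (hne y hy.le)),
        laplacian_inv_norm_sub_pow (by lia) (hne y hy.le)]
      simpa using hΔ y (hmem y hy'.le))
    (fun y hy => by
      have h1 : k * (ρ ^ (n - 2))⁻¹ = w p / 2 := by rw [hk]; field_simp
      have h2 : 0 ≤ k * (R ^ (n - 2))⁻¹ := by positivity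
      have h3 := hm y hy.le
      simp only [hy]
      linarith)
    (fun y hy => by simpa [hy] using hw y (hmem y hy.le)) x h hx.le
  refine lt_of_lt_of_le ?_ hcomp
  have hx0 : 0 < ‖x - p‖ := hρ0.trans_le h
  have : ‖x - p‖ ^ (n - 2) < R ^ (n - 2) := pow_lt_pow_left₀ hx hx0.le (by lia)
  have : (R ^ (n - 2))⁻¹ < (‖x - p‖ ^ (n - 2))⁻¹ := inv_strictAnti₀ (by positivity) this
  have := mul_lt_mul_of_pos_left this hk0
  linarith

/-- The strong maximum principle for nonnegative superharmonic functions. -/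
theorem pos_of_superharmonic (hn : 3 ≤ n) {U : Set (EuclideanSpace ℝ (Fin n))} (hU : IsOpen U)
    (hconn : IsPreconnected U) {w : EuclideanSpace ℝ (Fin n) → ℝ}
    (hs : ∀ x ∈ U, ContDiffAt ℝ 2 w x) (hΔ : ∀ x ∈ U, laplacian w x ≤ 0)
    (hw : ∀ x ∈ U, 0 ≤ w x) (hpos : ∃ p ∈ U, 0 < w p) :
    ∀ x ∈ U, 0 < w x := by
  have hc : ContinuousOn w U := fun x hx => (hs x hx).continuousAt.continuousWithinAt
  have hu : IsOpen (U ∩ w ⁻¹' Ioi 0) := hc.isOpen_inter_preimage hU isOpen_Ioi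
  have hv : IsOpen {x | x ∈ U ∧ w x = 0} := by
    rw [Metric.isOpen_iff]
    rintro q ⟨hqU, hq⟩
    obtain ⟨δ, hδ, hball⟩ := Metric.nhds_basis_closedBall.mem_iff.1 (hU.mem_nhds hqU)
    refine ⟨δ / 2, by positivity, fun y hy => ?_⟩
    rw [Metric.mem_ball] at hy
    have hsub : Metric.closedBall y (δ / 2) ⊆ U := fun z hz => hball <| by
      rw [Metric.mem_closedBall] at hz ⊢
      linarith [dist_triangle z y q]
    have hyU := hsub (Metric.mem_closedBall_self (by positivity))
    refine ⟨hyU, le_antisymm (not_lt.1 fun hy0 => ?_) (hw y hyU)⟩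
    have := pos_on_ball_of_superharmonic hn (fun x hx => hs x (hsub hx))
      (fun x hx => hΔ x (hsub hx)) (fun x hx => hw x (hsub hx)) hy0 q
      (by rwa [Metric.mem_ball, dist_comm])
    linarith
  have hdisj : Disjoint (U ∩ w ⁻¹' Ioi 0) {x | x ∈ U ∧ w x = 0} :=
    Set.disjoint_left.2 fun x hx hx' => hx.2.ne' hx'.2
  obtain ⟨p, hpU, hp⟩ := hpos
  have := hconn.subset_left_of_subset_union hu hv hdisj
    (fun x hx => (hw x hx).eq_or_lt.elim (fun h => Or.inr ⟨hx, h.symm⟩) fun h => Or.inl ⟨hx, h⟩)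
    ⟨p, hpU, hpU, hp⟩
  exact fun x hx => (this hx).2

theorem isOpen_annulus (a b : ℝ) : IsOpen (annulus n a b) :=
  (isOpen_lt continuous_const continuous_norm).inter (isOpen_lt continuous_norm continuous_const)

theorem isPreconnected_annulus (hn : 2 ≤ n) {a b : ℝ} (ha : 0 ≤ a) :
    IsPreconnected (annulus n a b) := by
  have hrank : 1 < Module.rank ℝ (EuclideanSpace ℝ (Fin n)) := by
    rw [← Module.finrank_eq_rank, finrank_euclideanSpace_fin]
    exact_mod_cast hn
  have himage : annulus n a b = (fun z : EuclideanSpace ℝ (Fin n) × ℝ => z.2 • z.1) ''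
      (Metric.sphere 0 1 ×ˢ Ioo a b) := by
    ext x
    constructor
    · rintro ⟨h1, h2⟩
      have hx : 0 < ‖x‖ := ha.trans_lt h1
      refine ⟨(‖x‖⁻¹ • x, ‖x‖), ⟨?_, h1, h2⟩, ?_⟩
      · simp [norm_smul, hx.ne']
      · simp [smul_smul, hx.ne']
    · rintro ⟨⟨v, t⟩, ⟨hv, ht⟩, rfl⟩
      have hv' : ‖v‖ = 1 := by simpa using hv
      simpa [annulus, norm_smul, hv', abs_of_pos (ha.trans_lt ht.1)] using ht
  rw [himage]
  exact ((isPreconnected_sphere hrank 0 1).prod isPreconnected_Ioo).image _ (by fun_prop)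

end MaximumPrinciple

/-- A positive solution of `Δφ = -μφ` in the annulus `a < |x| < 1` with zero boundary values. -/
structure IsPositiveEigenfunction {n : ℕ} (a μ : ℝ) (φ : EuclideanSpace ℝ (Fin n) → ℝ) :
    Prop where
  continuousOn : ContinuousOn φ {x | a ≤ ‖x‖ ∧ ‖x‖ ≤ 1}
  contDiffAt : ∀ x, a < ‖x‖ → ‖x‖ < 1 → ContDiffAt ℝ 2 φ x
  pos : ∀ x, a < ‖x‖ → ‖x‖ < 1 → 0 < φ x
  inner : ∀ x, ‖x‖ = a → φ x = 0
  outer : ∀ x, ‖x‖ = 1 → φ x = 0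
  laplacian_eq : ∀ x, a < ‖x‖ → ‖x‖ < 1 → laplacian φ x = -μ * φ x

section Barriers

variable {n : ℕ} {a : ℝ}

theorem isCompact_closedAnnulus (r R : ℝ) :
    IsCompact {x : EuclideanSpace ℝ (Fin n) | r ≤ ‖x‖ ∧ ‖x‖ ≤ R} :=
  (isCompact_closedBall 0 R).of_isClosed_subset
    ((isClosed_le continuous_const continuous_norm).inter
      (isClosed_le continuous_norm continuous_const)) fun x hx => by simpa using hx.2

theorem contDiffAt_inv_norm_pow (m : ℕ) {x : EuclideanSpace ℝ (Fin n)} (hx : 0 < ‖x‖) :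
    ContDiffAt ℝ 2 (fun y => (‖y‖ ^ m)⁻¹) x := by
  simpa using contDiffAt_inv_norm_sub_pow m (p := 0) (norm_pos_iff.1 hx)

theorem laplacian_inv_norm_pow (hn : 2 ≤ n) {x : EuclideanSpace ℝ (Fin n)} (hx : 0 < ‖x‖) :
    laplacian (fun y => (‖y‖ ^ (n - 2))⁻¹) x = 0 := by
  simpa using laplacian_inv_norm_sub_pow hn (p := 0) (norm_pos_iff.1 hx)

theorem contDiffAt_norm_sq' (x : EuclideanSpace ℝ (Fin n)) :
    ContDiffAt ℝ 2 (fun y : EuclideanSpace ℝ (Fin n) => ‖y‖ ^ 2) x :=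
  (contDiff_norm_sq ℝ).contDiffAt

/-- The functions `α - β|x|^{2-n} - γ|x|²` are the barriers used below. -/
theorem laplacian_barrier (hn : 2 ≤ n) (α β γ : ℝ) {x : EuclideanSpace ℝ (Fin n)}
    (hx : 0 < ‖x‖) :
    ContDiffAt ℝ 2 (fun y => α - β * (‖y‖ ^ (n - 2))⁻¹ - γ * ‖y‖ ^ 2) x ∧
      laplacian (fun y => α - β * (‖y‖ ^ (n - 2))⁻¹ - γ * ‖y‖ ^ 2) x = -(2 * n * γ) := by
  have h1 := contDiffAt_inv_norm_pow (n - 2) hx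
  have h2 : ContDiffAt ℝ 2 (fun y => β * (‖y‖ ^ (n - 2))⁻¹) x := contDiffAt_const.mul h1
  have h3 : ContDiffAt ℝ 2 (fun y => α - β * (‖y‖ ^ (n - 2))⁻¹) x := contDiffAt_const.sub h2
  have h4 : ContDiffAt ℝ 2 (fun y => γ * ‖y‖ ^ 2) x :=
    contDiffAt_const.mul (contDiffAt_norm_sq' x)
  refine ⟨h3.sub h4, ?_⟩
  rw [laplacian_sub h3 h4, laplacian_sub contDiffAt_const h2, laplacian_const,
    laplacian_const_mul β h1, laplacian_inv_norm_pow hn hx,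
    laplacian_const_mul γ (contDiffAt_norm_sq' x), laplacian_norm_sq]
  ring

theorem lower_bound_of_superharmonic (hn : 3 ≤ n) (ha : 0 < a)
    {w : EuclideanSpace ℝ (Fin n) → ℝ}
    (hc : ContinuousOn w {x | a ≤ ‖x‖ ∧ ‖x‖ ≤ 1})
    (hs : ∀ x, a < ‖x‖ → ‖x‖ < 1 → ContDiffAt ℝ 2 w x)
    (hΔ : ∀ x, a < ‖x‖ → ‖x‖ < 1 → laplacian w x ≤ 0)
    (hinner : ∀ x, ‖x‖ = a → 0 ≤ w x) (houter : ∀ x, ‖x‖ = 1 → 0 ≤ w x)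
    {ρ m : ℝ} (haρ : a < ρ) (hρ : ρ < 1) (hm : 0 ≤ m) (hw : ∀ x, ‖x‖ = ρ → m ≤ w x)
    (x : EuclideanSpace ℝ (Fin n)) (hax : a < ‖x‖) (hx1 : ‖x‖ < 1) :
    m * ρ ^ (n - 2) * ((1 - (a / ‖x‖) ^ (n - 2)) * (1 - ‖x‖)) ≤ w x := by
  have hρ0 : 0 < ρ := ha.trans haρ
  have hx0 : 0 < ‖x‖ := ha.trans hax
  have hρn : ρ ^ (n - 2) ≤ 1 := pow_le_one₀ hρ0.le hρ.le
  have hq1 : (a / ‖x‖) ^ (n - 2) ≤ 1 := pow_le_one₀ (by positivity) ((div_le_one hx0).2 hax.le)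
  have hq0 : 0 ≤ (a / ‖x‖) ^ (n - 2) := by positivity
  rcases le_total ‖x‖ ρ with h | h
  · have hbar := fun y : EuclideanSpace ℝ (Fin n) => fun hy : 0 < ‖y‖ =>
      laplacian_barrier (n := n) (by lia) m (m * a ^ (n - 2)) 0 hy
    have hcomp := le_of_laplacian_le_on_annulus (n := n) (by lia) (u := w) (r := a) (R := ρ)
      (v := fun y => m - m * a ^ (n - 2) * (‖y‖ ^ (n - 2))⁻¹ - 0 * ‖y‖ ^ 2)
      (hc.mono fun y hy => ⟨hy.1, hy.2.trans hρ.le⟩)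
      (fun y hy => (hbar y (ha.trans_le hy.1)).1.continuousAt.continuousWithinAt)
      (fun y hy hy' => hs y hy (hy'.trans hρ)) (fun y hy _ => (hbar y (ha.trans hy)).1)
      (fun y hy hy' => by
        rw [(hbar y (ha.trans hy)).2]
        simpa using hΔ y hy (hy'.trans hρ))
      (fun y hy => by
        simp only [hy]
        rw [mul_inv_cancel_right₀ (by positivity)]
        simpa using hinner y hy)
      (fun y hy => by
        have h1 := hw y hy
        have h2 : 0 ≤ m * a ^ (n - 2) * (‖y‖ ^ (n - 2))⁻¹ := by positivity
        linarith) x hax.le h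
    have h1 : m * (1 - (a / ‖x‖) ^ (n - 2)) ≤ w x := by
      refine le_trans (le_of_eq ?_) hcomp
      rw [div_pow]; ring
    refine le_trans ?_ h1
    have h2 : ρ ^ (n - 2) * (1 - ‖x‖) ≤ 1 := by nlinarith [pow_pos hρ0 (n - 2)]
    have h3 : 0 ≤ m * (1 - (a / ‖x‖) ^ (n - 2)) := mul_nonneg hm (by linarith)
    nlinarith [mul_le_mul_of_nonneg_left h2 h3]
  · set k := m * ρ ^ (n - 2) with hk
    have hk0 : 0 ≤ k := by positivity
    have hbar := fun y : EuclideanSpace ℝ (Fin n) => fun hy : 0 < ‖y‖ =>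
      laplacian_barrier (n := n) (by lia) (-k) (-k) 0 hy
    have hcomp := le_of_laplacian_le_on_annulus (n := n) (by lia) (u := w) (r := ρ) (R := 1)
      (v := fun y => -k - -k * (‖y‖ ^ (n - 2))⁻¹ - 0 * ‖y‖ ^ 2)
      (hc.mono fun y hy => ⟨haρ.le.trans hy.1, hy.2⟩)
      (fun y hy => (hbar y (hρ0.trans_le hy.1)).1.continuousAt.continuousWithinAt)
      (fun y hy hy' => hs y (haρ.trans hy) hy') (fun y hy _ => (hbar y (hρ0.trans hy)).1)
      (fun y hy hy' => by
        rw [(hbar y (hρ0.trans hy)).2]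
        simpa using hΔ y (haρ.trans hy) hy')
      (fun y hy => by
        have h1 := hw y hy
        have h2 : k * (ρ ^ (n - 2))⁻¹ = m := mul_inv_cancel_right₀ (by positivity) m
        simp only [hy]
        linarith)
      (fun y hy => by simpa [hy] using houter y hy) x h hx1.le
    have hinv : 1 - ‖x‖ ≤ (‖x‖ ^ (n - 2))⁻¹ - 1 := by
      have h1 : ‖x‖ ^ (n - 2) ≤ ‖x‖ := pow_le_of_le_one hx0.le hx1.le (by lia)
      have h2 : ‖x‖⁻¹ ≤ (‖x‖ ^ (n - 2))⁻¹ := inv_anti₀ (by positivity) h1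
      have h3 : 2 - ‖x‖ ≤ ‖x‖⁻¹ := by
        rw [le_inv_comm₀ (by linarith) hx0, inv_eq_one_div, le_div_iff₀ (by linarith)]
        nlinarith [sq_nonneg (1 - ‖x‖)]
      linarith
    have h1 : k * (1 - ‖x‖) ≤ w x := by
      have := mul_le_mul_of_nonneg_left hinv hk0
      linarith
    refine le_trans ?_ h1
    have h2 : 0 ≤ k * (1 - ‖x‖) := mul_nonneg hk0 (by linarith)
    nlinarith

theorem IsPositiveEigenfunction.upper_bound {μ Λ M : ℝ} {φ : EuclideanSpace ℝ (Fin n) → ℝ}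
    (h : IsPositiveEigenfunction a μ φ) (hn : 3 ≤ n) (ha : 0 < a) (ha2 : a ≤ 1 / 2)
    (hΛ : 0 ≤ Λ) (hμΛ : μ ≤ Λ) (hM : ∀ x, a ≤ ‖x‖ → ‖x‖ ≤ 1 → φ x ≤ M) (hM0 : 0 ≤ M)
    (x : EuclideanSpace ℝ (Fin n)) (hax : a < ‖x‖) (hx1 : ‖x‖ < 1) :
    φ x ≤ 4 * Λ / n * M * ((1 - (a / ‖x‖) ^ (n - 2)) * (1 - ‖x‖)) := by
  have hn0 : (0 : ℝ) < n := by exact_mod_cast (by lia : 0 < n)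
  have hx0 : 0 < ‖x‖ := ha.trans hax
  set k := Λ * M / (2 * n) with hk
  have hk0 : 0 ≤ k := by positivity
  have hk2 : 2 * n * k = Λ * M := by rw [hk]; field_simp
  have key : ∀ α β : ℝ, (∀ r, r = a → 0 ≤ α - β * (r ^ (n - 2))⁻¹ - k * r ^ 2) →
      0 ≤ α - β - k → φ x ≤ α - β * (‖x‖ ^ (n - 2))⁻¹ - k * ‖x‖ ^ 2 := by
    intro α β h1 h2
    have hbar := fun y : EuclideanSpace ℝ (Fin n) => fun hy : 0 < ‖y‖ =>
      laplacian_barrier (n := n) (by lia) α β k hy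
    refine le_of_laplacian_le_on_annulus (n := n) (by lia) (v := φ) (r := a) (R := 1)
      (u := fun y => α - β * (‖y‖ ^ (n - 2))⁻¹ - k * ‖y‖ ^ 2)
      (fun y hy => (hbar y (ha.trans_le hy.1)).1.continuousAt.continuousWithinAt)
      h.continuousOn (fun y hy _ => (hbar y (ha.trans hy)).1) h.contDiffAt
      (fun y hy hy' => ?_) (fun y hy => ?_) (fun y hy => ?_) x hax.le hx1.le
    · rw [(hbar y (ha.trans hy)).2, h.laplacian_eq y hy hy', hk2]
      have h3 := (h.pos y hy hy').le
      have h4 := hM y hy.le hy'.le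
      have h5 : μ * φ y ≤ Λ * φ y := mul_le_mul_of_nonneg_right hμΛ h3
      have h6 : Λ * φ y ≤ Λ * M := mul_le_mul_of_nonneg_left h4 hΛ
      linarith
    · rw [h.inner y hy]
      exact h1 _ hy
    · rw [h.outer y hy]
      simpa [hy] using h2
  have hout : φ x ≤ 2 * k * (1 - ‖x‖) := by
    have := key k 0 (fun r hr => by
      have ha1 : a ^ 2 ≤ 1 := pow_le_one₀ ha.le (by linarith)
      rw [hr]
      nlinarith [mul_le_mul_of_nonneg_left ha1 hk0]) (by linarith)
    nlinarith [mul_nonneg hk0 (sq_nonneg (1 - ‖x‖))]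
  have hin : φ x ≤ 2 * k * (1 - (a / ‖x‖) ^ (n - 2)) := by
    have hapow : a ^ (n - 2) ≤ 1 / 2 :=
      (pow_le_of_le_one ha.le (by linarith) (by lia)).trans ha2
    have := key (2 * k + k * a ^ 2) (2 * k * a ^ (n - 2))
      (fun r hr => by
        rw [hr, mul_inv_cancel_right₀ (by positivity)]
        linarith)
      (by nlinarith [mul_nonneg hk0 (sq_nonneg a)])
    have h2 : a ^ 2 ≤ ‖x‖ ^ 2 := pow_le_pow_left₀ ha.le hax.le 2
    have h3 : k * a ^ 2 ≤ k * ‖x‖ ^ 2 := mul_le_mul_of_nonneg_left h2 hk0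
    have h4 : (a / ‖x‖) ^ (n - 2) = a ^ (n - 2) * (‖x‖ ^ (n - 2))⁻¹ := by
      rw [div_pow, div_eq_mul_inv]
    rw [h4]
    linarith
  have hcoef : 4 * Λ / n * M = 8 * k := by rw [hk]; field_simp; ring
  rw [hcoef]
  have hq0 : 0 ≤ 1 - (a / ‖x‖) ^ (n - 2) :=
    sub_nonneg.2 (pow_le_one₀ (by positivity) ((div_le_one hx0).2 hax.le))
  rcases le_total ‖x‖ (3 / 4) with h34 | h34
  · nlinarith [mul_nonneg (mul_nonneg hk0 hq0) (by linarith : (0 : ℝ) ≤ 3 / 4 - ‖x‖)]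
  · have h1 : a / ‖x‖ ≤ 2 / 3 := by rw [div_le_iff₀ hx0]; linarith
    have h2 : (a / ‖x‖) ^ (n - 2) ≤ 2 / 3 :=
      (pow_le_of_le_one (by positivity) (by linarith) (by lia)).trans h1
    nlinarith [mul_nonneg (mul_nonneg hk0 (by linarith : 0 ≤ 1 - ‖x‖))
      (by linarith : 0 ≤ 2 / 3 - (a / ‖x‖) ^ (n - 2))]

end Barriers

section Symmetry

variable {n : ℕ} {a μ : ℝ} {φ φ₁ φ₂ : EuclideanSpace ℝ (Fin n) → ℝ}

theorem exists_euclideanSpace_norm_eq (hn : 0 < n) {r : ℝ} (hr : 0 ≤ r) :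
    ∃ x : EuclideanSpace ℝ (Fin n), ‖x‖ = r :=
  ⟨EuclideanSpace.single ⟨0, hn⟩ r, by simp [abs_of_nonneg hr]⟩

theorem IsPositiveEigenfunction.exists_isMax (h : IsPositiveEigenfunction a μ φ) (hn : 3 ≤ n)
    (ha : 0 < a) (ha2 : a ≤ 1 / 2) :
    ∃ z, a < ‖z‖ ∧ ‖z‖ < 1 ∧ ∀ x, a ≤ ‖x‖ → ‖x‖ ≤ 1 → φ x ≤ φ z := by
  obtain ⟨y, hy⟩ := exists_euclideanSpace_norm_eq (n := n) (by lia) (by norm_num : (0 : ℝ) ≤ 3 / 4)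
  obtain ⟨z, hz, hmax⟩ := (isCompact_closedAnnulus a 1).exists_isMaxOn
    ⟨y, show a ≤ ‖y‖ ∧ ‖y‖ ≤ 1 by constructor <;> linarith⟩ h.continuousOn
  have hy0 : 0 < φ z := (h.pos y (by linarith) (by linarith)).trans_le
    (hmax ⟨by linarith, by linarith⟩)
  refine ⟨z, hz.1.lt_of_ne fun he => ?_, hz.2.lt_of_ne fun he => ?_, fun x h1 h2 => hmax ⟨h1, h2⟩⟩
  · exact hy0.ne' (h.inner z he.symm)
  · exact hy0.ne' (h.outer z he)

/-- Two positive solutions of the same eigenvalue problem are proportional. -/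
theorem IsPositiveEigenfunction.proportional (h₁ : IsPositiveEigenfunction a μ φ₁)
    (h₂ : IsPositiveEigenfunction a μ φ₂) (hn : 3 ≤ n) (ha : 0 < a) (ha2 : a ≤ 1 / 2)
    (hμ : 0 ≤ μ) :
    ∃ t, 0 < t ∧ ∀ x, a < ‖x‖ → ‖x‖ < 1 → φ₁ x = t * φ₂ x := by
  obtain ⟨y, hy⟩ := exists_euclideanSpace_norm_eq (n := n) (by lia) (by norm_num : (0 : ℝ) ≤ 3 / 4)
  have hay : a < ‖y‖ := by linarith
  have hy1 : ‖y‖ < 1 := by linarith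
  set T : Set ℝ := {t | 0 ≤ t ∧ ∀ x, a < ‖x‖ → ‖x‖ < 1 → t * φ₂ x ≤ φ₁ x} with hT
  have hT0 : (0 : ℝ) ∈ T := ⟨le_rfl, fun x hx hx' => by simpa using (h₁.pos x hx hx').le⟩
  have hTb : BddAbove T := ⟨φ₁ y / φ₂ y, fun t ht => by
    rw [le_div_iff₀ (h₂.pos y hay hy1)]
    exact ht.2 y hay hy1⟩
  set t := sSup T with ht
  have ht0 : 0 ≤ t := le_csSup hTb hT0
  have htT : ∀ x, a < ‖x‖ → ‖x‖ < 1 → t * φ₂ x ≤ φ₁ x := fun x hx hx' => by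
    rw [← le_div_iff₀ (h₂.pos x hx hx')]
    exact csSup_le ⟨0, hT0⟩ fun s hs => by
      rw [le_div_iff₀ (h₂.pos x hx hx')]
      exact hs.2 x hx hx'
  have hw0 : ∀ x ∈ annulus n a 1, 0 ≤ φ₁ x - t * φ₂ x := fun x hx =>
    sub_nonneg.2 (htT x hx.1 hx.2)
  have hws : ∀ x, a < ‖x‖ → ‖x‖ < 1 → ContDiffAt ℝ 2 (fun x => φ₁ x - t * φ₂ x) x :=
    fun x hx hx' => (h₁.contDiffAt x hx hx').sub
      (contDiffAt_const.mul (h₂.contDiffAt x hx hx'))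
  have hwΔ : ∀ x, a < ‖x‖ → ‖x‖ < 1 → laplacian (fun x => φ₁ x - t * φ₂ x) x ≤ 0 := by
    intro x hx hx'
    rw [laplacian_sub (h₁.contDiffAt x hx hx') (contDiffAt_const.mul (h₂.contDiffAt x hx hx')),
      laplacian_const_mul t (h₂.contDiffAt x hx hx'), h₁.laplacian_eq x hx hx',
      h₂.laplacian_eq x hx hx']
    nlinarith [mul_nonneg hμ (hw0 x ⟨hx, hx'⟩)]
  by_cases hpos : ∃ p ∈ annulus n a 1, 0 < φ₁ p - t * φ₂ p
  · exfalso
    have hw := pos_of_superharmonic hn (isOpen_annulus a 1)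
      (isPreconnected_annulus (by lia) ha.le) (fun x hx => hws x hx.1 hx.2)
      (fun x hx => hwΔ x hx.1 hx.2) hw0 hpos
    have hsphere : ∀ x ∈ Metric.sphere (0 : EuclideanSpace ℝ (Fin n)) (3 / 4),
        a < ‖x‖ ∧ ‖x‖ < 1 := fun x hx => by
      rw [mem_sphere_zero_iff_norm] at hx
      constructor <;> linarith
    obtain ⟨z, hz, hmin⟩ := (isCompact_sphere (0 : EuclideanSpace ℝ (Fin n)) (3 / 4)).exists_isMinOn
      ⟨y, by simpa using hy⟩ (f := fun x => φ₁ x - t * φ₂ x)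
      fun x hx => (hws x (hsphere x hx).1 (hsphere x hx).2).continuousAt.continuousWithinAt
    set m := φ₁ z - t * φ₂ z with hm
    have hm0 : 0 < m := hw z (hsphere z hz)
    have hlow := lower_bound_of_superharmonic (w := fun x => φ₁ x - t * φ₂ x) hn ha
      (h₁.continuousOn.sub (continuousOn_const.mul h₂.continuousOn)) hws hwΔ
      (fun x hx => by simp [h₁.inner x hx, h₂.inner x hx])
      (fun x hx => by simp [h₁.outer x hx, h₂.outer x hx])
      (ρ := 3 / 4) (m := m) (by linarith) (by norm_num) hm0.le
      (fun x hx => hmin (by simpa using hx))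
    obtain ⟨p, hap, hp1, hp⟩ := h₂.exists_isMax hn ha ha2
    have hup := h₂.upper_bound hn ha ha2 hμ le_rfl hp (h₂.pos p hap hp1).le
    set A := m * (3 / 4) ^ (n - 2) with hA
    have hA0 : 0 < A := by positivity
    set B := 4 * μ / n * φ₂ p with hB
    have hB0 : 0 ≤ B := mul_nonneg (by positivity) (h₂.pos p hap hp1).le
    have hmem : t + A / (B + 1) ∈ T := by
      refine ⟨by positivity, fun x hx hx' => ?_⟩
      have h1 := hlow x hx hx'
      have h2 := hup x hx hx'
      set Ψ := (1 - (a / ‖x‖) ^ (n - 2)) * (1 - ‖x‖) with hΨ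
      have hΨ0 : 0 ≤ Ψ := mul_nonneg (sub_nonneg.2 (pow_le_one₀ (by positivity)
        ((div_le_one (ha.trans hx)).2 hx.le))) (by linarith)
      have h3 : A / (B + 1) * φ₂ x ≤ A / (B + 1) * ((B + 1) * Ψ) :=
        mul_le_mul_of_nonneg_left (by linarith) (by positivity)
      have h4 : A / (B + 1) * ((B + 1) * Ψ) = A * Ψ := by field_simp
      linarith
    have := le_csSup hTb hmem
    have : 0 < A / (B + 1) := by positivity
    linarith
  · push Not at hpos
    have heq : ∀ x, a < ‖x‖ → ‖x‖ < 1 → φ₁ x = t * φ₂ x := fun x hx hx' =>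
      le_antisymm (sub_nonpos.1 (hpos x ⟨hx, hx'⟩)) (htT x hx hx')
    refine ⟨t, ht0.lt_of_ne fun h0 => ?_, heq⟩
    have := h₁.pos y hay hy1
    rw [heq y hay hy1, ← h0] at this
    simp at this

theorem IsPositiveEigenfunction.comp_linearIsometryEquiv (h : IsPositiveEigenfunction a μ φ)
    (L : EuclideanSpace ℝ (Fin n) ≃ₗᵢ[ℝ] EuclideanSpace ℝ (Fin n)) :
    IsPositiveEigenfunction a μ fun x => φ (L x) where
  continuousOn := h.continuousOn.comp L.continuous.continuousOn fun x hx => by simpa using hx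
  contDiffAt x hx hx' := (h.contDiffAt (L x) (by simpa) (by simpa)).comp x L.contDiff.contDiffAt
  pos x hx hx' := h.pos _ (by simpa) (by simpa)
  inner x hx := h.inner _ (by simpa)
  outer x hx := h.outer _ (by simpa)
  laplacian_eq x hx hx' := by
    rw [laplacian_comp_linearIsometryEquiv L (h.contDiffAt _ (by simpa) (by simpa)),
      h.laplacian_eq _ (by simpa) (by simpa)]

theorem IsPositiveEigenfunction.radial (h : IsPositiveEigenfunction a μ φ) (hn : 3 ≤ n)
    (ha : 0 < a) (ha2 : a ≤ 1 / 2) (hμ : 0 ≤ μ) {x y : EuclideanSpace ℝ (Fin n)}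
    (hxy : ‖x‖ = ‖y‖) (hax : a < ‖x‖) (hx1 : ‖x‖ < 1) : φ x = φ y := by
  set L := (ℝ ∙ (x - y))ᗮ.reflection with hL
  obtain ⟨t, ht, hLt⟩ := h.proportional (h.comp_linearIsometryEquiv L) hn ha ha2 hμ
  have h1 := hLt x hax hx1
  have h2 := hLt (L x) (by simpa) (by simpa)
  simp only [hL, Submodule.reflection_reflection] at h2
  rw [← hL] at h2
  have hp := h.pos x hax hx1
  have ht1 : t = 1 := by
    have h3 : φ x * (t * t - 1) = 0 := by
      rw [h2] at h1
      linear_combination -h1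
    have h4 : t * t - 1 = 0 := (mul_eq_zero.1 h3).resolve_left hp.ne'
    nlinarith
  rw [h1, ht1, one_mul, hL, Submodule.reflection_sub hxy]

/-- Past a maximum point the eigenfunction decays at most quadratically. -/
theorem IsPositiveEigenfunction.quadratic_lower_bound (h : IsPositiveEigenfunction a μ φ)
    (hn : 3 ≤ n) (ha : 0 < a) (ha2 : a ≤ 1 / 2) (hμ : 0 ≤ μ) {z : EuclideanSpace ℝ (Fin n)}
    (haz : a < ‖z‖) (hz1 : ‖z‖ < 1) (hz : ∀ x, a ≤ ‖x‖ → ‖x‖ ≤ 1 → φ x ≤ φ z)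
    {x : EuclideanSpace ℝ (Fin n)} (hzx : ‖z‖ ≤ ‖x‖) (hx1 : ‖x‖ ≤ 1) :
    φ z * (1 - μ / (2 * n) * (‖x‖ ^ 2 - ‖z‖ ^ 2)) ≤ φ x := by
  have hn0 : (0 : ℝ) < n := by exact_mod_cast (by lia : 0 < n)
  have hφz := h.pos z haz hz1
  set k := μ * φ z / (2 * n) with hk
  have hk0 : 0 ≤ k := by positivity
  have hk2 : 2 * n * k = μ * φ z := by rw [hk]; field_simp
  have hgoal : φ z * (1 - μ / (2 * n) * (‖x‖ ^ 2 - ‖z‖ ^ 2)) =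
      φ z + k * ‖z‖ ^ 2 - k * ‖x‖ ^ 2 := by rw [hk]; ring
  rw [hgoal]
  set D := max (φ x + k * ‖x‖ ^ 2) (k * a ^ 2) with hD
  have hq : ∀ y : EuclideanSpace ℝ (Fin n), ContDiffAt ℝ 2 (fun y => -k * ‖y‖ ^ 2) y := fun y =>
    contDiffAt_const.mul (contDiffAt_norm_sq' y)
  have hcomp := le_of_laplacian_le_on_annulus (n := n) (by lia) (u := fun _ => D)
    (v := fun y => φ y - -k * ‖y‖ ^ 2) (r := a) (R := ‖x‖) continuousOn_const
    ((h.continuousOn.mono fun y hy => ⟨hy.1, hy.2.trans hx1⟩).sub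
      fun y _ => (hq y).continuousAt.continuousWithinAt)
    (fun y _ _ => contDiffAt_const)
    (fun y hy hy' => (h.contDiffAt y hy (hy'.trans_le hx1)).sub (hq y))
    (fun y hy hy' => by
      have hy1 := hy'.trans_le hx1
      rw [laplacian_const, laplacian_sub (h.contDiffAt y hy hy1) (hq y),
        laplacian_const_mul _ (contDiffAt_norm_sq' y), laplacian_norm_sq, h.laplacian_eq y hy hy1]
      nlinarith [mul_le_mul_of_nonneg_left (hz y hy.le hy1.le) hμ])
    (fun y hy => by
      rw [h.inner y hy, hy]
      exact le_trans (by linarith) (le_max_right _ _))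
    (fun y hy => by
      have hyx : φ y = φ x := by
        rcases hx1.eq_or_lt with h1 | h1
        · rw [h.outer x h1, h.outer y (hy.trans h1)]
        · exact h.radial hn ha ha2 hμ hy (by linarith) (by linarith)
      rw [hyx, hy]
      exact le_trans (by linarith) (le_max_left _ _)) z haz.le hzx
  have ha' : k * a ^ 2 ≤ k * ‖z‖ ^ 2 :=
    mul_le_mul_of_nonneg_left (pow_le_pow_left₀ ha.le haz.le 2) hk0
  rcases le_max_iff.1 hcomp with h1 | h1
  · linarith
  · linarith

end Symmetry

section UnitAnnulus

variable {n : ℕ} {a μ : ℝ} {φ : EuclideanSpace ℝ (Fin n) → ℝ}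

theorem IsPositiveEigenfunction.integrableOn_sq (h : IsPositiveEigenfunction a μ φ) :
    IntegrableOn (fun x => φ x ^ 2) {x | a ≤ ‖x‖ ∧ ‖x‖ ≤ 1} :=
  (h.continuousOn.pow 2).integrableOn_compact (isCompact_closedAnnulus a 1)

/-- A closed ball of radius `r` around a point of norm `t` lies in the shell `t ± r`. -/
theorem norm_mem_of_mem_closedBall {E : Type*} [SeminormedAddCommGroup E] {p x : E} {r : ℝ}
    (hx : x ∈ Metric.closedBall p r) : ‖p‖ - r ≤ ‖x‖ ∧ ‖x‖ ≤ ‖p‖ + r := by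
  have hd : ‖x - p‖ ≤ r := by simpa [dist_eq_norm] using hx
  have h1 := abs_le.1 ((abs_norm_sub_norm_le x p).trans hd)
  constructor <;> linarith [h1.1, h1.2]

theorem IsPositiveEigenfunction.exists_half_max_shell (h : IsPositiveEigenfunction a μ φ)
    (hn : 3 ≤ n) (ha : 0 < a) (ha2 : a ≤ 1 / 2) (hμ : 0 ≤ μ) {Λ : ℝ} (hΛ : 0 < Λ) (hμΛ : μ ≤ Λ)
    {z : EuclideanSpace ℝ (Fin n)} (haz : a < ‖z‖) (hz1 : ‖z‖ < 1)
    (hz : ∀ x, a ≤ ‖x‖ → ‖x‖ ≤ 1 → φ x ≤ φ z) :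
    ∃ ρ, ‖z‖ + n / Λ / 2 ≤ ρ ∧ ρ < 1 ∧ ∀ x, ‖z‖ ≤ ‖x‖ → ‖x‖ ≤ ρ → φ z / 2 ≤ φ x := by
  have hnpos : (0 : ℝ) < n := by positivity
  have hM : 0 < φ z := h.pos z haz hz1
  obtain ⟨e, he⟩ := exists_euclideanSpace_norm_eq (n := n) (by omega) zero_le_one
  have hgap : 2 * n ≤ Λ * (1 - ‖z‖ ^ 2) := by
    have h1 := h.quadratic_lower_bound hn ha ha2 hμ haz hz1 hz (x := e) (by linarith) he.le
    rw [h.outer e he, he] at h1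
    have h2 : 1 - μ / (2 * n) * (1 ^ 2 - ‖z‖ ^ 2) ≤ 0 := by
      by_contra! hc
      linarith [mul_pos hM hc]
    have h3 : 1 ≤ μ * (1 - ‖z‖ ^ 2) / (2 * n) := by
      have : μ / (2 * n) * (1 ^ 2 - ‖z‖ ^ 2) = μ * (1 - ‖z‖ ^ 2) / (2 * n) := by ring
      linarith
    rw [le_div_iff₀ (by positivity)] at h3
    have h4 : μ * (1 - ‖z‖ ^ 2) ≤ Λ * (1 - ‖z‖ ^ 2) := by
      gcongr
      nlinarith [norm_nonneg z]
    linarith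
  set δ : ℝ := n / Λ with hδ
  have hδ0 : 0 < δ := by positivity
  have hΛδ : Λ * δ = n := by rw [hδ]; field_simp
  have hδ1 : ‖z‖ ^ 2 + 2 * δ ≤ 1 := by
    by_contra! hc
    nlinarith
  have hs : 0 ≤ ‖z‖ ^ 2 + δ := by positivity
  have hsq : √(‖z‖ ^ 2 + δ) ^ 2 = ‖z‖ ^ 2 + δ := Real.sq_sqrt hs
  have hρ0 := Real.sqrt_nonneg (‖z‖ ^ 2 + δ)
  set ρ := √(‖z‖ ^ 2 + δ)
  have hρ1 : ρ < 1 := by nlinarith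
  have hzρ : ‖z‖ < ρ := by nlinarith [norm_nonneg z]
  refine ⟨ρ, by nlinarith, hρ1, fun x hzx hxρ => ?_⟩
  refine le_trans ?_ (h.quadratic_lower_bound hn ha ha2 hμ haz hz1 hz hzx (by linarith))
  have h5 : ‖x‖ ^ 2 - ‖z‖ ^ 2 ≤ δ := by nlinarith [norm_nonneg x]
  have h5' : 0 ≤ ‖x‖ ^ 2 - ‖z‖ ^ 2 := by nlinarith [norm_nonneg z]
  have h6 : μ / (2 * n) * (‖x‖ ^ 2 - ‖z‖ ^ 2) ≤ Λ / (2 * n) * δ := by gcongr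
  have h7 : Λ / (2 * n) * δ = 1 / 2 := by
    rw [div_mul_eq_mul_div, hΛδ]; field_simp
  nlinarith

theorem IsPositiveEigenfunction.le_sq_max (h : IsPositiveEigenfunction a μ φ)
    (hint : ∫ x in annulus n a 1, φ x ^ 2 = 1) {M : ℝ}
    (hM : ∀ x, a ≤ ‖x‖ → ‖x‖ ≤ 1 → φ x ≤ M) :
    1 ≤ M ^ 2 * volume.real (Metric.ball (0 : EuclideanSpace ℝ (Fin n)) 1) := by
  have hsub : annulus n a 1 ⊆ Metric.ball 0 1 := fun x hx => by simpa using hx.2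
  have hfin : volume (annulus n a 1) ≠ ⊤ :=
    measure_ne_top_of_subset hsub measure_ball_lt_top.ne
  calc (1 : ℝ) = ∫ x in annulus n a 1, φ x ^ 2 := hint.symm
    _ ≤ ∫ x in annulus n a 1, M ^ 2 := by
      refine setIntegral_mono_on (h.integrableOn_sq.mono_set fun x hx => ⟨hx.1.le, hx.2.le⟩)
        (integrableOn_const hfin) (isOpen_annulus a 1).measurableSet fun x hx => ?_
      have := hM x hx.1.le hx.2.le
      have := h.pos x hx.1 hx.2
      gcongr
    _ = M ^ 2 * volume.real (annulus n a 1) := by simp [mul_comm]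
    _ ≤ _ := by
      gcongr
      exact measure_ball_lt_top.ne

theorem IsPositiveEigenfunction.sq_mul_volume_le (h : IsPositiveEigenfunction a μ φ)
    (hint : ∫ x in annulus n a 1, φ x ^ 2 = 1) {p : EuclideanSpace ℝ (Fin n)} {m r : ℝ}
    (hr : 0 ≤ r) (hp : Metric.closedBall p r ⊆ annulus n a 1) (hm : 0 ≤ m)
    (hφ : ∀ x ∈ Metric.closedBall p r, m ≤ φ x) :
    m ^ 2 * (r ^ n * volume.real (Metric.ball (0 : EuclideanSpace ℝ (Fin n)) 1)) ≤ 1 := by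
  have hi : IntegrableOn (fun x => φ x ^ 2) (annulus n a 1) :=
    h.integrableOn_sq.mono_set fun x hx => ⟨hx.1.le, hx.2.le⟩
  have hv := Measure.addHaar_real_closedBall (volume : Measure (EuclideanSpace ℝ (Fin n))) p hr
  rw [finrank_euclideanSpace_fin] at hv
  rw [← hv, ← hint]
  refine (setIntegral_ge_of_const_le_real Metric.isClosed_closedBall.measurableSet
    measure_closedBall_lt_top.ne (fun x hx => ?_) (hi.mono_set hp)).trans
    (setIntegral_mono_set hi (Eventually.of_forall fun x => sq_nonneg _)
      (LE.le.eventuallyLE hp))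
  exact pow_le_pow_left₀ hm (hφ x hx) 2

/-- Two-sided bounds in the unit annulus, uniform in the inner radius. -/
theorem exists_two_sided_bound (hn : 3 ≤ n) {Λ : ℝ} (hΛ : 0 < Λ) :
    ∃ c > (0 : ℝ), ∃ C > (0 : ℝ), ∀ (a μ : ℝ) (φ : EuclideanSpace ℝ (Fin n) → ℝ), 0 < a →
      a ≤ 1 / 2 → 0 ≤ μ → μ ≤ Λ → IsPositiveEigenfunction a μ φ →
      ∫ x in annulus n a 1, φ x ^ 2 = 1 → ∀ x ∈ annulus n a 1,
        c * ((1 - (a / ‖x‖) ^ (n - 2)) * (1 - ‖x‖)) ≤ φ x ∧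
          φ x ≤ C * ((1 - (a / ‖x‖) ^ (n - 2)) * (1 - ‖x‖)) := by
  have hnpos : (0 : ℝ) < n := by positivity
  set ω := volume.real (Metric.ball (0 : EuclideanSpace ℝ (Fin n)) 1) with hω
  have hω0 : 0 < ω := by
    refine ENNReal.toReal_pos (Metric.measure_ball_pos _ _ one_pos).ne' measure_ball_lt_top.ne
  set δ : ℝ := n / Λ with hδ
  have hδ0 : 0 < δ := by positivity
  refine ⟨√(1 / ω) / 2 * (δ / 2) ^ (n - 2), by positivity,
    4 * Λ / n * √(4 / ((δ / 4) ^ n * ω)), by positivity, ?_⟩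
  intro a μ φ ha ha2 hμ hμΛ h hint x hx
  obtain ⟨z, haz, hz1, hz⟩ := h.exists_isMax hn ha ha2
  have hz0 : 0 < ‖z‖ := ha.trans haz
  have hM : 0 < φ z := h.pos z haz hz1
  obtain ⟨ρ, hρ, hρ1, hhalf⟩ := h.exists_half_max_shell hn ha ha2 hμ hΛ hμΛ haz hz1 hz
  rw [← hδ] at hρ
  have hnonneg : 0 ≤ (1 - (a / ‖x‖) ^ (n - 2)) * (1 - ‖x‖) := by
    have hx0 : 0 < ‖x‖ := ha.trans hx.1
    refine mul_nonneg (sub_nonneg.2 (pow_le_one₀ (by positivity) ?_)) (sub_nonneg.2 hx.2.le)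
    exact (div_le_one hx0).2 hx.1.le
  constructor
  · have hlow : √(1 / ω) ≤ φ z := by
      rw [Real.sqrt_le_left hM.le, div_le_iff₀ hω0]
      exact h.le_sq_max hint hz
    refine le_trans ?_ (lower_bound_of_superharmonic (w := φ) hn ha h.continuousOn
      (fun y h1 h2 => h.contDiffAt y h1 h2) (fun y h1 h2 => ?_) (fun y hy => (h.inner y hy).ge)
      (fun y hy => (h.outer y hy).ge) (ρ := ρ) (m := φ z / 2) (by linarith) hρ1 (by positivity)
      (fun y hy => hhalf y (by linarith) hy.le) x hx.1 hx.2)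
    · have : δ / 2 ≤ ρ := by linarith
      gcongr
    · rw [h.laplacian_eq y h1 h2]
      nlinarith [h.pos y h1 h2]
  · have hup : φ z ≤ √(4 / ((δ / 4) ^ n * ω)) := by
      refine Real.le_sqrt_of_sq_le ?_
      set p : EuclideanSpace ℝ (Fin n) := ((‖z‖ + δ / 4) / ‖z‖) • z
      have hp : ‖p‖ = ‖z‖ + δ / 4 := by
        rw [norm_smul, Real.norm_of_nonneg (by positivity), div_mul_cancel₀ _ hz0.ne']
      have hb : ∀ y ∈ Metric.closedBall p (δ / 4), ‖z‖ ≤ ‖y‖ ∧ ‖y‖ ≤ ρ := fun y hy => by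
        have := norm_mem_of_mem_closedBall hy
        constructor <;> linarith [this.1, this.2]
      have h1 := h.sq_mul_volume_le hint (p := p) (r := δ / 4) (m := φ z / 2) (by positivity)
        (fun y hy => ⟨haz.trans_le (hb y hy).1, (hb y hy).2.trans_lt hρ1⟩) (by positivity)
        (fun y hy => hhalf y (hb y hy).1 (hb y hy).2)
      rw [le_div_iff₀ (by positivity)]
      linarith
    refine (h.upper_bound hn ha ha2 hΛ.le hμΛ hz hM.le x hx.1 hx.2).trans ?_
    gcongr

end UnitAnnulus

section Scaling

variable {n : ℕ}

theorem dirichletEigenvalue_nonneg (U : Set (EuclideanSpace ℝ (Fin n))) :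
    0 ≤ dirichletEigenvalue n U := by
  refine Real.sInf_nonneg ?_
  rintro R ⟨f, -, -, -, -, rfl⟩
  positivity

theorem dirichletEigenvalue_le {U : Set (EuclideanSpace ℝ (Fin n))}
    {f : EuclideanSpace ℝ (Fin n) → ℝ} (hf : ContDiff ℝ (⊤ : ℕ∞) f) (hc : HasCompactSupport f)
    (hU : tsupport f ⊆ U) (h0 : f ≠ 0) :
    dirichletEigenvalue n U ≤ (∫ x, ‖fderiv ℝ f x‖ ^ 2) / (∫ x, (f x) ^ 2) := by
  refine csInf_le ⟨0, ?_⟩ ⟨f, hf, hc, hU, h0, rfl⟩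
  rintro R ⟨g, -, -, -, -, rfl⟩
  positivity

/-- A test function for `1/2 < |x| < 1` bounds the first eigenvalue of every thick annulus. -/
theorem sq_mul_dirichletEigenvalue_annulus_le {g : EuclideanSpace ℝ (Fin n) → ℝ}
    (hg : ContDiff ℝ (⊤ : ℕ∞) g) (hc : HasCompactSupport g)
    (hs : tsupport g ⊆ annulus n (1 / 2) 1) (h0 : g ≠ 0) {a b : ℝ} (hb : 0 < b)
    (hab : a ≤ b / 2) :
    b ^ 2 * dirichletEigenvalue n (annulus n a b) ≤
      (∫ x, ‖fderiv ℝ g x‖ ^ 2) / (∫ x, (g x) ^ 2) := by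
  have hb' : b⁻¹ ≠ 0 := inv_ne_zero hb.ne'
  have hsupp : tsupport (fun x => g (b⁻¹ • x)) ⊆ annulus n a b := fun x hx => by
    have h2 := hs (tsupport_comp_subset_preimage g (continuous_const_smul b⁻¹) hx)
    have h3 : ‖b⁻¹ • x‖ = ‖x‖ / b := by
      rw [norm_smul, Real.norm_of_nonneg (by positivity), inv_mul_eq_div]
    have h4 := h2.1
    have h5 := h2.2
    rw [h3, lt_div_iff₀ hb] at h4
    rw [h3, div_lt_one hb] at h5
    exact ⟨by linarith, h5⟩
  have h0' : (fun x => g (b⁻¹ • x)) ≠ 0 := fun h => h0 <| funext fun x => by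
    simpa [smul_smul, hb.ne'] using congrFun h (b • x)
  have hle := dirichletEigenvalue_le (hg.comp (contDiff_const_smul b⁻¹)) (hc.comp_smul hb')
    hsupp h0'
  have hfd : ∀ x, ‖fderiv ℝ (fun x => g (b⁻¹ • x)) x‖ ^ 2 =
      (b⁻¹) ^ 2 * ‖fderiv ℝ g (b⁻¹ • x)‖ ^ 2 := fun x => by
    rw [fderiv_comp_smul, norm_smul, mul_pow, Real.norm_eq_abs, sq_abs]
  change _ ≤ (∫ x, ‖fderiv ℝ (fun x => g (b⁻¹ • x)) x‖ ^ 2) / ∫ x, g (b⁻¹ • x) ^ 2 at hle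
  simp only [hfd] at hle
  rw [integral_const_mul, Measure.integral_comp_smul _ (fun x => ‖fderiv ℝ g x‖ ^ 2),
    Measure.integral_comp_smul _ (fun x => g x ^ 2), smul_eq_mul, smul_eq_mul, mul_left_comm,
    mul_div_mul_left _ _ (by positivity), mul_div_assoc] at hle
  refine (mul_le_mul_of_nonneg_left hle (sq_nonneg b)).trans_eq ?_
  rw [← mul_assoc, ← mul_pow, mul_inv_cancel₀ hb.ne', one_pow, one_mul]

/-- A uniform scale-invariant upper bound for the first eigenvalue of a thick annulus. -/
theorem exists_sq_mul_dirichletEigenvalue_le (hn : 0 < n) :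
    ∃ Λ > (0 : ℝ), ∀ a b : ℝ, 0 < b → a ≤ b / 2 →
      b ^ 2 * dirichletEigenvalue n (annulus n a b) ≤ Λ := by
  obtain ⟨p, hp⟩ := exists_euclideanSpace_norm_eq hn (by norm_num : (0 : ℝ) ≤ 3 / 4)
  let η : ContDiffBump p := ⟨1 / 16, 1 / 8, by norm_num, by norm_num⟩
  have hs : tsupport η ⊆ annulus n (1 / 2) 1 := fun x hx => by
    rw [η.tsupport_eq] at hx
    have h2 := norm_mem_of_mem_closedBall hx
    change ‖p‖ - 1 / 8 ≤ ‖x‖ ∧ ‖x‖ ≤ ‖p‖ + 1 / 8 at h2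
    constructor <;> linarith [h2.1, h2.2]
  have h0 : (η : EuclideanSpace ℝ (Fin n) → ℝ) ≠ 0 := fun h => by
    have h1 := η.one_of_mem_closedBall (Metric.mem_closedBall_self η.rIn_pos.le)
    exact one_ne_zero (h1.symm.trans (congrFun h p))
  have hR : 0 ≤ (∫ x, ‖fderiv ℝ η x‖ ^ 2) / (∫ x, (η x) ^ 2) :=
    div_nonneg (integral_nonneg fun x => sq_nonneg _) (integral_nonneg fun x => sq_nonneg _)
  exact ⟨_, add_pos_of_nonneg_of_pos hR one_pos, fun a b hb hab =>
    (sq_mul_dirichletEigenvalue_annulus_le η.contDiff η.hasCompactSupport hs h0 hb hab).trans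
      (le_add_of_nonneg_right zero_le_one)⟩

theorem mem_closure_annulus {a b : ℝ} (ha : 0 < a) (hab : a < b) {x : EuclideanSpace ℝ (Fin n)}
    (hax : a ≤ ‖x‖) (hxb : ‖x‖ ≤ b) : x ∈ closure (annulus n a b) := by
  have hx : 0 < ‖x‖ := ha.trans_le hax
  have h1 : (1 : ℝ) ∈ closure (Ioo (a / ‖x‖) (b / ‖x‖)) := by
    rw [closure_Ioo (by gcongr : a / ‖x‖ < b / ‖x‖).ne]
    exact ⟨(div_le_one hx).2 hax, (one_le_div hx).2 hxb⟩
  have h2 : MapsTo (fun t : ℝ => t • x) (Ioo (a / ‖x‖) (b / ‖x‖)) (annulus n a b) := by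
    intro t ht
    have ht0 : 0 < t := lt_trans (by positivity) ht.1
    have h3 : ‖t • x‖ = t * ‖x‖ := by rw [norm_smul, Real.norm_of_nonneg ht0.le]
    exact ⟨by rw [h3]; exact (div_lt_iff₀ hx).1 ht.1, by rw [h3]; exact (lt_div_iff₀ hx).1 ht.2⟩
  simpa using map_mem_closure (continuous_id.smul continuous_const) h1 h2

theorem mem_frontier_annulus {a b : ℝ} (ha : 0 < a) (hab : a < b) {x : EuclideanSpace ℝ (Fin n)}
    (hx : ‖x‖ = a ∨ ‖x‖ = b) : x ∈ frontier (annulus n a b) := by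
  rw [(isOpen_annulus a b).frontier_eq]
  refine ⟨?_, fun h => ?_⟩
  · rcases hx with hx | hx <;> exact mem_closure_annulus ha hab (by linarith) (by linarith)
  · rcases hx with hx | hx <;> linarith [h.1, h.2]

theorem smul_mem_annulus_iff {a b : ℝ} (hb : 0 < b) {y : EuclideanSpace ℝ (Fin n)} :
    b • y ∈ annulus n a b ↔ a / b < ‖y‖ ∧ ‖y‖ < 1 := by
  simp only [annulus, mem_ofPred_eq, norm_smul, Real.norm_of_nonneg hb.le, div_lt_iff₀ hb]
  rw [mul_comm ‖y‖ b, mul_lt_iff_lt_one_right hb]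

theorem IsPrincipalDirichletEigenfunction.rescale {a b : ℝ} (ha : 0 < a) (hab : a < b)
    {φ : EuclideanSpace ℝ (Fin n) → ℝ}
    (h : IsPrincipalDirichletEigenfunction (annulus n a b) φ) {k : ℝ} (hk : 0 < k) :
    IsPositiveEigenfunction (a / b) (b ^ 2 * dirichletEigenvalue n (annulus n a b))
      (fun y => k * φ (b • y)) := by
  have hb : 0 < b := ha.trans hab
  have hnorm : ∀ y : EuclideanSpace ℝ (Fin n), ‖b • y‖ = b * ‖y‖ := fun y => by
    rw [norm_smul, Real.norm_of_nonneg hb.le]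
  have hsm : ∀ y : EuclideanSpace ℝ (Fin n), a / b < ‖y‖ → ‖y‖ < 1 →
      ContDiffAt ℝ 2 (fun y => φ (b • y)) y := fun y h1 h2 => by
    have h3 : ContDiffAt ℝ 2 φ (b • y) :=
      contDiffAt_infty.1 (h.smooth.contDiffAt ((isOpen_annulus a b).mem_nhds
        ((smul_mem_annulus_iff hb).2 ⟨h1, h2⟩))) 2
    exact h3.comp y (contDiff_const_smul b).contDiffAt
  refine ⟨?_, fun y h1 h2 => contDiffAt_const.mul (hsm y h1 h2), fun y h1 h2 => ?_,
    fun y hy => ?_, fun y hy => ?_, fun y h1 h2 => ?_⟩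
  · refine continuousOn_const.mul (h.continuousOn.comp (continuous_const_smul b).continuousOn ?_)
    rintro y ⟨h1, h2⟩
    rw [div_le_iff₀ hb, mul_comm] at h1
    exact mem_closure_annulus ha hab (by rwa [hnorm]) (by rw [hnorm]; nlinarith)
  · exact mul_pos hk (h.pos _ ((smul_mem_annulus_iff hb).2 ⟨h1, h2⟩))
  · rw [h.vanishes _ (mem_frontier_annulus ha hab (.inl ?_)), mul_zero]
    rw [hnorm, hy, mul_div_cancel₀ _ hb.ne']
  · rw [h.vanishes _ (mem_frontier_annulus ha hab (.inr ?_)), mul_zero]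
    rw [hnorm, hy, mul_one]
  · rw [laplacian_const_mul k (hsm y h1 h2), laplacian_comp_smul,
      h.eigenEq _ ((smul_mem_annulus_iff hb).2 ⟨h1, h2⟩)]
    ring

open scoped Pointwise in
theorem smul_annulus {a b : ℝ} (hb : 0 < b) :
    b • annulus n (a / b) 1 = annulus n a b := by
  ext x
  rw [mem_smul_set_iff_inv_smul_mem₀ hb.ne']
  conv_rhs => rw [← smul_inv_smul₀ hb.ne' x]
  exact (smul_mem_annulus_iff hb).symm

end Scaling

theorem stmt_19 (n : ℕ) (hn : 3 ≤ n) :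
    ∃ c > (0 : ℝ), ∃ C > (0 : ℝ), ∀ a b : ℝ, 0 < a → a < b →
      a / b ∈ Set.Ioc (0 : ℝ) (1 / 2) →
      ∀ φ : EuclideanSpace ℝ (Fin n) → ℝ,
        IsPrincipalDirichletEigenfunction (annulus n a b) φ →
        ∀ x ∈ annulus n a b,
          c * (b ^ (-(n : ℝ) / 2) * (1 - (a / ‖x‖) ^ (n - 2)) * (1 - ‖x‖ / b)) ≤ φ x ∧
          φ x ≤ C * (b ^ (-(n : ℝ) / 2) * (1 - (a / ‖x‖) ^ (n - 2)) * (1 - ‖x‖ / b)) := by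
  obtain ⟨Λ, hΛ, hΛle⟩ := exists_sq_mul_dirichletEigenvalue_le (n := n) (by omega)
  obtain ⟨c, hc, C, hC, hbound⟩ := exists_two_sided_bound hn hΛ
  refine ⟨c, hc, C, hC, fun a b ha hab hratio φ hφ x hx => ?_⟩
  have hb : 0 < b := ha.trans hab
  have hab2 : a ≤ b / 2 := by
    have := (div_le_iff₀ hb).1 hratio.2
    linarith
  set k : ℝ := b ^ ((n : ℝ) / 2) with hk
  have hk0 : 0 < k := Real.rpow_pos_of_pos hb _
  have hksq : k ^ 2 = b ^ n := by
    rw [hk, ← Real.rpow_natCast, ← Real.rpow_mul hb.le, ← Real.rpow_natCast]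
    congr 1
    push_cast
    ring
  have hkinv : b ^ (-(n : ℝ) / 2) = k⁻¹ := by rw [neg_div, Real.rpow_neg hb.le]
  have hint : ∫ y in annulus n (a / b) 1, (k * φ (b • y)) ^ 2 = 1 := by
    simp only [mul_pow]
    rw [integral_const_mul, Measure.setIntegral_comp_smul_of_pos _ (fun y => φ y ^ 2) _ hb,
      smul_annulus hb, hφ.normalized, finrank_euclideanSpace_fin, hksq, smul_eq_mul, mul_one,
      mul_inv_cancel₀ (by positivity)]
  have hy : b • b⁻¹ • x = x := smul_inv_smul₀ hb.ne' x
  have hmem : b⁻¹ • x ∈ annulus n (a / b) 1 := (smul_mem_annulus_iff hb).1 (by rwa [hy])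
  have hnorm : ‖b⁻¹ • x‖ = ‖x‖ / b := by
    rw [norm_smul, Real.norm_of_nonneg (by positivity), inv_mul_eq_div]
  have hx0 : 0 < ‖x‖ := ha.trans hx.1
  have hdiv : a / b / (‖x‖ / b) = a / ‖x‖ := div_div_div_cancel_right₀ hb.ne' _ _
  obtain ⟨hlow, hup⟩ := hbound (a / b) _ _ (by positivity) hratio.2
    (mul_nonneg (sq_nonneg b) (dirichletEigenvalue_nonneg _)) (hΛle a b hb hab2)
    (hφ.rescale ha hab hk0) hint _ hmem
  simp only [hy, hnorm, hdiv] at hlow hup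
  have hassoc : ∀ d : ℝ, d * (b ^ (-(n : ℝ) / 2) * (1 - (a / ‖x‖) ^ (n - 2)) * (1 - ‖x‖ / b)) =
      d * ((1 - (a / ‖x‖) ^ (n - 2)) * (1 - ‖x‖ / b)) / k := fun d => by
    rw [hkinv]; ring
  rw [hassoc, hassoc, div_le_iff₀ hk0, le_div_iff₀ hk0, mul_comm (φ x) k]
  exact ⟨hlow, hup⟩
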